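/- arXiv:1407.0092 — 5 statements merged into one kernel-verified Lean document; each statement's English description precedes it below -/
import Mathlib

section
/- Let k > 0. Let v : ℝ → ℝ be continuously differentiable, even, 2π-periodic, and satisfy v'(x) ≠ 0 for every x ∈ (0, π). Let u : ℝ → ℝ be continuous, odd, satisfy u(x + 2π) = u(x) + 2π/k for all x ∈ ℝ, and satisfy ∫₀^π u(x) dx = π²/(2k). Then the map x ↦ (u(x), v(x)) is injective on ℝ if and only if 0 < u(x) < π/k for every x ∈ (0, π). -/
open Real Set

/-- A continuous function avoiding `c` on an open interval stays on one side of `c`. -/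
theorem forall_lt_or_forall_gt_of_ne {u : ℝ → ℝ} (hu : Continuous u) {a b c : ℝ}
    (h : ∀ x ∈ Ioo a b, u x ≠ c) :
    (∀ x ∈ Ioo a b, u x < c) ∨ ∀ x ∈ Ioo a b, c < u x := by
  by_contra! hcon
  obtain ⟨⟨x, hx, hcx⟩, y, hy, hyc⟩ := hcon
  obtain ⟨z, hz, hzc⟩ := isPreconnected_Ioo.intermediate_value hy hx hu.continuousOn ⟨hyc, hcx⟩
  exact h z hz hzc

theorem injOn_Icc_of_deriv_ne_zero {v : ℝ → ℝ} (hv : Continuous v) {a b : ℝ}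
    (h : ∀ x ∈ Ioo a b, deriv v x ≠ 0) : InjOn v (Icc a b) := by
  have aux : ∀ x ∈ Icc a b, ∀ y ∈ Icc a b, v x = v y → ¬ x < y := by
    intro x hx y hy hxy hlt
    obtain ⟨z, hz, hz'⟩ := exists_deriv_eq_zero hlt hv.continuousOn hxy
    exact h z ⟨hx.1.trans_lt hz.1, hz.2.trans_le hy.2⟩ hz'
  intro x hx y hy hxy
  exact le_antisymm (not_lt.1 (aux y hy x hx hxy.symm)) (not_lt.1 (aux x hx y hy hxy))

/-- Every real number lies within half a period of an integer multiple of `2 * π`. -/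
theorem exists_int_abs_sub_mul_two_pi_le (x : ℝ) : ∃ m : ℤ, |x - m * (2 * π)| ≤ π := by
  refine ⟨round (x / (2 * π)), ?_⟩
  have hpos : 0 < 2 * π := two_pi_pos
  have h := mul_le_mul_of_nonneg_right (abs_sub_round (x / (2 * π))) hpos.le
  rw [← abs_of_pos hpos, ← abs_mul, abs_of_pos hpos, sub_mul, div_mul_cancel₀ _ hpos.ne'] at h
  linarith

theorem apply_add_int_mul_of_shift {u : ℝ → ℝ} {p c : ℝ} (hp : p ≠ 0)
    (h : ∀ x, u (x + p) = u x + c) (x : ℝ) (m : ℤ) : u (x + m * p) = u x + m * c := by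
  have hper : Function.Periodic (fun x => u x - x / p * c) p := by
    intro y
    simp only [h]
    field_simp
    ring
  have hm := hper.int_mul m x
  field_simp at hm
  exact mul_left_cancel₀ hp (by linarith)

/-- Injectivity Lemma: the boundary parametrization `x ↦ (u x, v x)` of the free
surface is injective iff `0 < u x < π / k` on `(0, π)`. -/
theorem injectivity_lemma (k : ℝ) (hk : 0 < k) (u v : ℝ → ℝ)
    (hv : ContDiff ℝ 1 v)
    (hveven : ∀ x, v (-x) = v x)
    (hvper : ∀ x, v (x + 2 * π) = v x)
    (hv' : ∀ x ∈ Ioo (0 : ℝ) π, deriv v x ≠ 0)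
    (hu : Continuous u)
    (huodd : ∀ x, u (-x) = -u x)
    (hushift : ∀ x, u (x + 2 * π) = u x + 2 * π / k)
    (huint : (∫ x in (0 : ℝ)..π, u x) = π ^ 2 / (2 * k)) :
    Function.Injective (fun x => (u x, v x)) ↔
      ∀ x ∈ Ioo (0 : ℝ) π, 0 < u x ∧ u x < π / k := by
  have hkπ : 2 * π / k = 2 * (π / k) := by ring
  have hπk : 0 < π / k := div_pos pi_pos hk
  constructor
  · intro hinj
    have hne_zero : ∀ x ∈ Ioo (0 : ℝ) π, u x ≠ 0 := by
      intro x hx h0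
      have hx' : -x = x := hinj (Prod.ext (by simp [huodd, h0]) (hveven x))
      linarith [hx.1]
    have hne_top : ∀ x ∈ Ioo (0 : ℝ) π, u x ≠ π / k := by
      intro x hx h0
      have hx' : -x + 2 * π = x := by
        refine hinj (Prod.ext ?_ ((hvper (-x)).trans (hveven x)))
        simp only [hushift, huodd, h0, hkπ]
        ring
      linarith [hx.2]
    have hpos : ∀ x ∈ Ioo (0 : ℝ) π, 0 < u x := by
      refine (forall_lt_or_forall_gt_of_ne hu hne_zero).resolve_left fun hneg => ?_
      have hle := intervalIntegral.integral_mono_on_of_le_Ioo (μ := MeasureTheory.volume)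
        pi_pos.le (hu.intervalIntegrable 0 π)
        (continuous_const.intervalIntegrable 0 π) fun x hx => (hneg x hx).le
      rw [huint, intervalIntegral.integral_const, smul_zero] at hle
      have : 0 < π ^ 2 / (2 * k) := by positivity
      linarith
    have hlt : ∀ x ∈ Ioo (0 : ℝ) π, u x < π / k := by
      refine (forall_lt_or_forall_gt_of_ne hu hne_top).resolve_right fun hgt => ?_
      have hle := intervalIntegral.integral_mono_on_of_le_Ioo (μ := MeasureTheory.volume)
        pi_pos.le (continuous_const.intervalIntegrable 0 π)
        (hu.intervalIntegrable 0 π) fun x hx => (hgt x hx).le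
      rw [huint, intervalIntegral.integral_const, smul_eq_mul, sub_zero] at hle
      have h1 : π ^ 2 / (2 * k) = π * (π / k) / 2 := by field_simp
      have : 0 < π * (π / k) := by positivity
      linarith
    exact fun x hx => ⟨hpos x hx, hlt x hx⟩
  · intro hbd x y hxy
    obtain ⟨huxy, hvxy⟩ := Prod.ext_iff.1 hxy
    simp only at huxy hvxy
    have hvabs : ∀ z, v |z| = v z := by
      intro z
      rcases abs_choice z with h | h <;> simp [h, hveven]
    have hv_shift : ∀ z (m : ℤ), v (z + m * (2 * π)) = v z := fun z m =>
      Function.Periodic.int_mul hvper m z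
    have hu_shift := apply_add_int_mul_of_shift two_pi_pos.ne' hushift
    have hu_zero : u 0 = 0 := by
      have := huodd 0
      rw [neg_zero] at this
      linarith
    have hu_pi : u π = π / k := by
      have := hushift (-π)
      rw [huodd, show -π + 2 * π = π by ring] at this
      linarith
    -- Two points reducing to opposite residues `a` and `-a` coincide.
    have key : ∀ a : ℝ, 0 ≤ a → a ≤ π → ∀ m n : ℤ,
        u (a + m * (2 * π)) = u (-a + n * (2 * π)) →
        a + m * (2 * π) = -a + n * (2 * π) := by
      intro a ha0 haπ m n h
      rw [hu_shift, hu_shift, huodd, hkπ] at h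
      have hua : u a = ((n - m : ℤ) : ℝ) * (π / k) := by
        push_cast
        linarith
      rcases ha0.eq_or_lt with rfl | ha0
      · rw [hu_zero, zero_eq_mul, or_iff_left hπk.ne'] at hua
        push_cast at hua
        rw [show (n : ℝ) = m by linarith]
        ring
      rcases haπ.eq_or_lt with rfl | haπ
      · rw [hu_pi, eq_comm, mul_eq_right₀ hπk.ne'] at hua
        push_cast at hua
        rw [show (n : ℝ) = m + 1 by linarith]
        ring
      · obtain ⟨h0, h1⟩ := hbd a ⟨ha0, haπ⟩
        rw [hua] at h0 h1
        have hj0 : (0 : ℝ) < ((n - m : ℤ) : ℝ) := pos_of_mul_pos_left h0 hπk.le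
        have hj1 : ((n - m : ℤ) : ℝ) < 1 := (mul_lt_iff_lt_one_left hπk).1 h1
        have hj0' : 0 < n - m := by exact_mod_cast hj0
        have hj1' : n - m < 1 := by exact_mod_cast hj1
        omega
    obtain ⟨m, hm⟩ := exists_int_abs_sub_mul_two_pi_le x
    obtain ⟨n, hn⟩ := exists_int_abs_sub_mul_two_pi_le y
    obtain ⟨r, rfl⟩ : ∃ r, x = r + m * (2 * π) := ⟨x - m * (2 * π), by ring⟩
    obtain ⟨s, rfl⟩ : ∃ s, y = s + n * (2 * π) := ⟨y - n * (2 * π), by ring⟩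
    rw [add_sub_cancel_right] at hm hn
    rw [hv_shift, hv_shift, ← hvabs r, ← hvabs s] at hvxy
    have hrs : |r| = |s| := injOn_Icc_of_deriv_ne_zero hv.continuous hv'
      ⟨abs_nonneg r, hm⟩ ⟨abs_nonneg s, hn⟩ hvxy
    rcases abs_eq_abs.1 hrs with rfl | rfl
    · rw [hu_shift, hu_shift, add_right_inj] at huxy
      rw [mul_right_cancel₀ (by rw [hkπ]; positivity) huxy]
    · rcases le_total 0 s with hs | hs
      · exact (key s hs ((le_abs_self s).trans hn) n m huxy.symm).symm
      · have h := key (-s) (neg_nonneg.2 hs) ((neg_le_abs s).trans hn) m n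
        rw [neg_neg] at h
        exact h huxy
end

section
/- Let d > 0. For every s ∈ ℝ, the family indexed by k ∈ ℤ with terms tanh(π(s + 2πk)/(2d)) − sgn(k) is (absolutely) summable, where sgn(k) = 1 for k > 0, sgn(k) = −1 for k < 0 and sgn(0) = 0. Moreover the function g(s) = Σ_{k ∈ ℤ} ( tanh(π(s + 2πk)/(2d)) − sgn(k) ) is continuous on ℝ and satisfies g(s + 2π) = g(s) + 2 for every s ∈ ℝ. -/
open Real

/-- The kernel component `g` of the periodic Hilbert transform for a strip. -/
noncomputable def gKernel (d s : ℝ) : ℝ :=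
  ∑' j : ℤ, (Real.tanh (π * (s + 2 * π * j) / (2 * d)) - (Int.sign j : ℝ))

theorem Real.one_sub_tanh_le_two_mul_exp (x : ℝ) : 1 - Real.tanh x ≤ 2 * Real.exp (-2 * x) := by
  have h : 1 - Real.tanh x = 2 * Real.exp (-x) / (Real.exp x + Real.exp (-x)) := by
    rw [Real.tanh_eq]
    have : Real.exp x + Real.exp (-x) ≠ 0 := by positivity
    field_simp
    ring
  rw [h, div_le_iff₀ (by positivity)]
  have h1 : Real.exp (-2 * x) * Real.exp x = Real.exp (-x) := by
    rw [← Real.exp_add]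
    ring_nf
  have h2 : 0 < Real.exp (-2 * x) * Real.exp (-x) := by positivity
  nlinarith

theorem Real.continuous_tanh : Continuous Real.tanh := by
  simp only [funext Real.tanh_eq_sinh_div_cosh]
  exact Real.continuous_sinh.div Real.continuous_cosh fun x => (Real.cosh_pos x).ne'

theorem Real.abs_tanh_sub_sign_le (x : ℝ) (j : ℤ) :
    |Real.tanh x - (Int.sign j : ℝ)| ≤ 2 * Real.exp (-2 * ((Int.sign j : ℝ) * x)) := by
  rcases lt_trichotomy j 0 with hj | rfl | hj
  · have := Real.one_sub_tanh_le_two_mul_exp (-x)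
    rw [Real.tanh_neg] at this
    rw [Int.sign_eq_neg_one_of_neg hj, abs_of_nonneg]
    · push_cast
      rw [neg_one_mul]
      linarith
    · push_cast
      linarith [Real.neg_one_lt_tanh x]
  · have := Real.abs_tanh_lt_one x
    simp only [Int.sign_zero, Int.cast_zero, sub_zero, zero_mul, mul_zero, Real.exp_zero]
    linarith
  · have := Real.one_sub_tanh_le_two_mul_exp x
    rw [Int.sign_eq_one_of_pos hj, abs_sub_comm, abs_of_nonneg]
    · simpa using this
    · push_cast
      linarith [Real.tanh_lt_one x]

theorem abs_gKernel_term_le {d : ℝ} (hd : 0 < d) {s R : ℝ} (hs : |s| ≤ R) (j : ℤ) :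
    |Real.tanh (π * (s + 2 * π * j) / (2 * d)) - (Int.sign j : ℝ)| ≤
      2 * Real.exp (π * R / d) * Real.exp (-(2 * π ^ 2 / d)) ^ j.natAbs := by
  refine (Real.abs_tanh_sub_sign_le _ j).trans ?_
  rw [mul_assoc 2 (Real.exp _), ← Real.exp_nat_mul, ← Real.exp_add]
  gcongr
  have hj : (Int.sign j : ℝ) * j = (j.natAbs : ℝ) := by
    rw [← Int.cast_mul, Int.sign_mul_self_eq_abs, Int.abs_eq_natAbs, Int.cast_natCast]
  have hR : -((Int.sign j : ℝ) * s) ≤ R := by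
    have := abs_le.mp hs
    rcases lt_trichotomy j 0 with hj | rfl | hj
    · rw [Int.sign_eq_neg_one_of_neg hj]
      push_cast
      linarith
    · simpa using (abs_nonneg s).trans hs
    · rw [Int.sign_eq_one_of_pos hj]
      push_cast
      linarith
  calc -2 * ((Int.sign j : ℝ) * (π * (s + 2 * π * j) / (2 * d)))
      = π * -((Int.sign j : ℝ) * s) / d - 2 * π ^ 2 / d * ((Int.sign j : ℝ) * j) := by
        field_simp
        ring
    _ ≤ π * R / d + (j.natAbs : ℝ) * -(2 * π ^ 2 / d) := by
        rw [hj]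
        have : π * -((Int.sign j : ℝ) * s) / d ≤ π * R / d := by gcongr
        linarith

theorem summable_pow_natAbs {r : ℝ} (h0 : 0 ≤ r) (h1 : r < 1) :
    Summable fun j : ℤ => r ^ j.natAbs := by
  have := summable_geometric_of_lt_one h0 h1
  exact Summable.of_nat_of_neg (by simpa using this) (by simpa using this)

theorem summable_gKernel_bound {d : ℝ} (hd : 0 < d) (R : ℝ) :
    Summable fun j : ℤ =>
      2 * Real.exp (π * R / d) * Real.exp (-(2 * π ^ 2 / d)) ^ j.natAbs :=
  (summable_pow_natAbs (Real.exp_pos _).le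
    (Real.exp_lt_one_iff.mpr (neg_neg_of_pos (by positivity)))).mul_left _

theorem summable_abs_gKernel_term {d : ℝ} (hd : 0 < d) (s : ℝ) :
    Summable fun j : ℤ =>
      |Real.tanh (π * (s + 2 * π * j) / (2 * d)) - (Int.sign j : ℝ)| :=
  .of_nonneg_of_le (fun _ => abs_nonneg _) (abs_gKernel_term_le hd le_rfl)
    (summable_gKernel_bound hd |s|)

theorem continuous_gKernel {d : ℝ} (hd : 0 < d) : Continuous (gKernel d) := by
  rw [continuous_iff_continuousAt]
  intro s
  have hc : ContinuousOn (gKernel d) (Metric.closedBall 0 (|s| + 1)) := by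
    refine continuousOn_tsum (fun j => ?_) (summable_gKernel_bound hd (|s| + 1))
      fun j x hx => abs_gKernel_term_le hd (by simpa using hx) j
    exact ((Real.continuous_tanh.comp (by fun_prop)).sub continuous_const).continuousOn
  refine hc.continuousAt (Metric.closedBall_mem_nhds_of_mem ?_)
  simp

theorem hasSum_sign_add_one_sub_sign :
    HasSum (fun j : ℤ => (Int.sign (j + 1) : ℝ) - (Int.sign j : ℝ)) 2 := by
  have h : HasSum (fun j : ℤ => (Int.sign (j + 1) : ℝ) - (Int.sign j : ℝ))
      (∑ j ∈ ({-1, 0} : Finset ℤ), ((Int.sign (j + 1) : ℝ) - (Int.sign j : ℝ))) := by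
    refine hasSum_sum_of_ne_finset_zero fun j hj => ?_
    simp only [Finset.mem_insert, Finset.mem_singleton, not_or] at hj
    rcases lt_or_ge j 0 with h | h
    · rw [Int.sign_eq_neg_one_of_neg h, Int.sign_eq_neg_one_of_neg (by omega), sub_self]
    · rw [Int.sign_eq_one_of_pos (by omega), Int.sign_eq_one_of_pos (by omega), sub_self]
  convert h using 1
  norm_num

theorem gKernel_add_two_pi {d : ℝ} (hd : 0 < d) (s : ℝ) :
    gKernel d (s + 2 * π) = gKernel d s + 2 := by
  have h := ((Equiv.addRight (1 : ℤ)).hasSum_iff.mpr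
    (summable_abs_gKernel_term hd s).of_abs.hasSum).add hasSum_sign_add_one_sub_sign
  refine Eq.trans (tsum_congr fun j => ?_) h.tsum_eq
  simp only [Function.comp_apply, Equiv.coe_addRight, Int.cast_add, Int.cast_one]
  ring_nf

/-- For `d > 0`, the family `k ↦ tanh (π (s + 2πk) / (2d)) - sgn k` is absolutely
summable for every `s`, the sum `g` is continuous on `ℝ`, and `g (s + 2π) = g s + 2`. -/
theorem gKernel_summable_continuous_shift (d : ℝ) (hd : 0 < d) :
    (∀ s : ℝ,
      Summable (fun j : ℤ =>
        |Real.tanh (π * (s + 2 * π * j) / (2 * d)) - (Int.sign j : ℝ)|)) ∧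
    Continuous (gKernel d) ∧
    (∀ s : ℝ, gKernel d (s + 2 * π) = gKernel d s + 2) :=
  ⟨summable_abs_gKernel_term hd, continuous_gKernel hd, gKernel_add_two_pi hd⟩
end

section
/- Let g > 0, k > 0, h > 0 and Υ ∈ ℝ. For each positive integer n define λ*_{n,+} = Υ·tanh(nkh)/(2nk) + √( Υ²·tanh²(nkh)/(4n²k²) + g·tanh(nkh)/(nk) ) and λ*_{n,−} = Υ·tanh(nkh)/(2nk) − √( Υ²·tanh²(nkh)/(4n²k²) + g·tanh(nkh)/(nk) ). Then for every n, λ*_{n,−} < 0 < λ*_{n,+}; and all these values are pairwise distinct: for positive integers m ≠ n one has λ*_{m,+} ≠ λ*_{n,+} and λ*_{m,−} ≠ λ*_{n,−} (moreover λ*_{m,+} ≠ λ*_{n,−} for all m, n). -/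
open Real

/-- The bifurcation value `λ*_{n,+}`. -/
noncomputable def lamPlus (g k h Υ : ℝ) (n : ℕ) : ℝ :=
  Υ * Real.tanh ((n : ℝ) * k * h) / (2 * (n : ℝ) * k) +
    Real.sqrt (Υ ^ 2 * Real.tanh ((n : ℝ) * k * h) ^ 2 / (4 * (n : ℝ) ^ 2 * k ^ 2) +
      g * Real.tanh ((n : ℝ) * k * h) / ((n : ℝ) * k))

/-- The bifurcation value `λ*_{n,−}`. -/
noncomputable def lamMinus (g k h Υ : ℝ) (n : ℕ) : ℝ :=
  Υ * Real.tanh ((n : ℝ) * k * h) / (2 * (n : ℝ) * k) -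
    Real.sqrt (Υ ^ 2 * Real.tanh ((n : ℝ) * k * h) ^ 2 / (4 * (n : ℝ) ^ 2 * k ^ 2) +
      g * Real.tanh ((n : ℝ) * k * h) / ((n : ℝ) * k))

/-- The function `x ↦ tanh x / x` is strictly decreasing on the positive half-line. -/
theorem strictAntiOn_tanh_div_self :
    StrictAntiOn (fun x : ℝ => Real.tanh x / x) (Set.Ioi 0) := by
  have hd : ∀ x ∈ Set.Ioi (0 : ℝ), HasDerivAt (fun x : ℝ => Real.sinh x / (Real.cosh x * x))
      ((Real.cosh x * (Real.cosh x * x) -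
        Real.sinh x * (Real.sinh x * x + Real.cosh x * 1)) / (Real.cosh x * x) ^ 2) x := by
    intro x hx
    exact (Real.hasDerivAt_sinh x).div ((Real.hasDerivAt_cosh x).mul (hasDerivAt_id x))
      (mul_pos (Real.cosh_pos x) hx).ne'
  have heq : (fun x : ℝ => Real.tanh x / x) = fun x => Real.sinh x / (Real.cosh x * x) := by
    funext x
    rw [Real.tanh_eq_sinh_div_cosh, div_div]
  rw [heq]
  refine strictAntiOn_of_deriv_neg (convex_Ioi 0)
    (fun x hx => (hd x hx).continuousAt.continuousWithinAt) fun x hx => ?_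
  rw [interior_Ioi] at hx
  rw [(hd x hx).deriv]
  have hx0 : 0 < x := hx
  refine div_neg_of_neg_of_pos ?_ (pow_pos (mul_pos (Real.cosh_pos x) hx) 2)
  have hs : x < Real.sinh x := Real.self_lt_sinh_iff.2 hx
  have hc : 1 ≤ Real.cosh x := Real.one_le_cosh x
  have hcs : Real.cosh x * (Real.cosh x * x) -
      Real.sinh x * (Real.sinh x * x + Real.cosh x * 1) = x - Real.sinh x * Real.cosh x := by
    linear_combination x * Real.cosh_sq x
  rw [hcs]
  nlinarith

theorem tanh_pos_of_pos {x : ℝ} (hx : 0 < x) : 0 < Real.tanh x := by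
  rw [Real.tanh_eq_sinh_div_cosh]
  exact div_pos (Real.sinh_pos_iff.2 hx) (Real.cosh_pos x)

theorem abs_lt_sqrt_sq_add {a b : ℝ} (hb : 0 < b) : |a| < √(a ^ 2 + b) :=
  Real.lt_sqrt_of_sq_lt (by rw [sq_abs]; linarith)

/-- A nonzero solution `l` of `l ^ 2 = T * (g + c * l)` determines `T`. -/
theorem eq_of_sq_eq_mul {g c l S T : ℝ} (hl : l ≠ 0)
    (hS : l ^ 2 = S * (g + c * l)) (hT : l ^ 2 = T * (g + c * l)) : S = T := by
  have hne : g + c * l ≠ 0 := by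
    intro h0
    rw [h0, mul_zero] at hS
    exact hl (pow_eq_zero_iff two_ne_zero |>.1 hS)
  exact mul_right_cancel₀ hne (hS.symm.trans hT)

theorem lamPlus_eq (g k h Υ : ℝ) (n : ℕ) :
    lamPlus g k h Υ n = Υ * (Real.tanh (n * k * h) / (n * k)) / 2 +
      √((Υ * (Real.tanh (n * k * h) / (n * k)) / 2) ^ 2 +
        g * (Real.tanh (n * k * h) / (n * k))) := by
  unfold lamPlus
  congr 1
  · ring
  · congr 1
    ring

theorem lamMinus_eq (g k h Υ : ℝ) (n : ℕ) :
    lamMinus g k h Υ n = Υ * (Real.tanh (n * k * h) / (n * k)) / 2 -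
      √((Υ * (Real.tanh (n * k * h) / (n * k)) / 2) ^ 2 +
        g * (Real.tanh (n * k * h) / (n * k))) := by
  unfold lamMinus
  congr 1
  · ring
  · congr 1
    ring

/-- The bifurcation values `λ*_{n,±}` satisfy `λ*_{n,−} < 0 < λ*_{n,+}` and are all
pairwise distinct. -/
theorem bifurcation_values_distinct (g k h Υ : ℝ) (hg : 0 < g) (hk : 0 < k) (hh : 0 < h) :
    (∀ n : ℕ, 0 < n → lamMinus g k h Υ n < 0 ∧ 0 < lamPlus g k h Υ n) ∧
    (∀ m n : ℕ, 0 < m → 0 < n → m ≠ n →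
      lamPlus g k h Υ m ≠ lamPlus g k h Υ n ∧
      lamMinus g k h Υ m ≠ lamMinus g k h Υ n) ∧
    (∀ m n : ℕ, 0 < m → 0 < n → lamPlus g k h Υ m ≠ lamMinus g k h Υ n) := by
  have hT : ∀ n : ℕ, 0 < n → 0 < Real.tanh (n * k * h) / (n * k) := fun n hn => by
    have hn' : (0 : ℝ) < n := Nat.cast_pos.2 hn
    exact div_pos (tanh_pos_of_pos (by positivity)) (by positivity)
  have hinj : ∀ m n : ℕ, 0 < m → 0 < n →
      Real.tanh (m * k * h) / (m * k) = Real.tanh (n * k * h) / (n * k) → m = n := by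
    intro m n hm hn hmn
    have hm' : (0 : ℝ) < m := Nat.cast_pos.2 hm
    have hn' : (0 : ℝ) < n := Nat.cast_pos.2 hn
    have hx : (m : ℝ) * k * h = n * k * h := by
      refine strictAntiOn_tanh_div_self.injOn (Set.mem_Ioi.2 (by positivity))
        (Set.mem_Ioi.2 (by positivity)) ?_
      simp only [← div_div _ (_ * k) h, hmn]
    exact_mod_cast mul_right_cancel₀ hk.ne' (mul_right_cancel₀ hh.ne' hx)
  have hsign : ∀ n : ℕ, 0 < n → lamMinus g k h Υ n < 0 ∧ 0 < lamPlus g k h Υ n := by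
    intro n hn
    have hlt := abs_lt.1 (abs_lt_sqrt_sq_add
      (a := Υ * (Real.tanh (n * k * h) / (n * k)) / 2) (mul_pos hg (hT n hn)))
    rw [lamMinus_eq, lamPlus_eq]
    constructor <;> linarith [hlt.1, hlt.2]
  have hsq : ∀ n : ℕ, 0 < n →
      √((Υ * (Real.tanh (n * k * h) / (n * k)) / 2) ^ 2 +
        g * (Real.tanh (n * k * h) / (n * k))) ^ 2 =
      (Υ * (Real.tanh (n * k * h) / (n * k)) / 2) ^ 2 +
        g * (Real.tanh (n * k * h) / (n * k)) := fun n hn =>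
    Real.sq_sqrt (add_nonneg (sq_nonneg _) (mul_pos hg (hT n hn)).le)
  have hplus : ∀ n : ℕ, 0 < n → lamPlus g k h Υ n ^ 2 =
      Real.tanh (n * k * h) / (n * k) * (g + Υ * lamPlus g k h Υ n) := by
    intro n hn
    rw [lamPlus_eq]
    linear_combination hsq n hn
  have hminus : ∀ n : ℕ, 0 < n → lamMinus g k h Υ n ^ 2 =
      Real.tanh (n * k * h) / (n * k) * (g + Υ * lamMinus g k h Υ n) := by
    intro n hn
    rw [lamMinus_eq]
    linear_combination hsq n hn
  refine ⟨hsign, fun m n hm hn hmn => ⟨fun he => hmn ?_, fun he => hmn ?_⟩, fun m n hm hn =>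
    ((hsign n hn).1.trans (hsign m hm).2).ne'⟩
  · exact hinj m n hm hn
      (eq_of_sq_eq_mul (hsign m hm).2.ne' (hplus m hm) (he ▸ hplus n hn))
  · exact hinj m n hm hn
      (eq_of_sq_eq_mul (hsign m hm).1.ne (hminus m hm) (he ▸ hminus n hn))
end

section
/- Let g > 0, h > 0, k > 0 and Υ ∈ ℝ, and set λ = Υ·tanh(kh)/(2k) − √( Υ²·tanh²(kh)/(4k²) + g·tanh(kh)/k ). Then there exists Y ∈ [0, h] with Υ·Y + λ − Υ·h = 0 if and only if Υ < 0 and tanh(kh)/(kh) ≤ Υ²h/(g + Υ²h). Moreover, in that case the solution Y is unique, equal to h − λ/Υ, and satisfies Y < h. -/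
open Real Set

/-- The minus branch of the quadratic formula for `x ^ 2 - Υ T x - g T` is a negative root. -/
lemma neg_and_sq_eq_of_eq_sub_sqrt {g T Υ x : ℝ} (hg : 0 < g) (hT : 0 < T)
    (hx : x = Υ * T / 2 - √(Υ ^ 2 * T ^ 2 / 4 + g * T)) :
    x < 0 ∧ x ^ 2 = Υ * T * x + g * T := by
  have hgT : 0 < g * T := mul_pos hg hT
  have hsq := Real.sq_sqrt (show 0 ≤ Υ ^ 2 * T ^ 2 / 4 + g * T by positivity)
  constructor
  · rw [hx, sub_neg]
    exact Real.lt_sqrt_of_sq_lt (by linear_combination hgT)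
  · rw [hx]
    linear_combination hsq

/-- A negative number lies at or below the negative root `x` of `x ^ 2 - Υ T x - g T` iff the
quadratic is nonnegative there. -/
lemma le_neg_root_iff {g T Υ x y : ℝ} (hx : x < 0) (hg : 0 < g) (hT : 0 < T)
    (hquad : x ^ 2 = Υ * T * x + g * T) (hy : y < 0) :
    y ≤ x ↔ 0 ≤ y ^ 2 - Υ * T * y - g * T := by
  have hgT : 0 < g * T := mul_pos hg hT
  have hother : 0 < Υ * T - x := by
    by_contra! hle
    nlinarith [mul_nonneg_of_nonpos_of_nonpos hx.le hle]
  have hfactor : y ^ 2 - Υ * T * y - g * T = (x - y) * (Υ * T - x - y) := by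
    linear_combination hquad
  rw [hfactor, mul_nonneg_iff_of_pos_right (by linarith), sub_nonneg]

/-- Critical points of the bifurcating laminar flow associated with `λ*_{1,−}`:
a point `Y ∈ [0, h]` with `Υ Y + λ − Υ h = 0` exists iff `Υ < 0` and
`tanh (kh)/(kh) ≤ Υ²h/(g + Υ²h)`; in that case it is unique, equal to `h − λ/Υ`,
and lies strictly below the surface `Y = h`. -/
theorem critical_layer_laminar_flow (g h k Υ : ℝ) (hg : 0 < g) (hh : 0 < h) (hk : 0 < k)
    (lam : ℝ)
    (hlam : lam = Υ * Real.tanh (k * h) / (2 * k) -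
      Real.sqrt (Υ ^ 2 * Real.tanh (k * h) ^ 2 / (4 * k ^ 2) + g * Real.tanh (k * h) / k)) :
    ((∃ Y ∈ Icc (0 : ℝ) h, Υ * Y + lam - Υ * h = 0) ↔
      (Υ < 0 ∧ Real.tanh (k * h) / (k * h) ≤ Υ ^ 2 * h / (g + Υ ^ 2 * h))) ∧
    ((Υ < 0 ∧ Real.tanh (k * h) / (k * h) ≤ Υ ^ 2 * h / (g + Υ ^ 2 * h)) →
      (∀ Y ∈ Icc (0 : ℝ) h, Υ * Y + lam - Υ * h = 0 → Y = h - lam / Υ) ∧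
      h - lam / Υ < h) := by
  have htanh : 0 < Real.tanh (k * h) := by
    rw [Real.tanh_eq_sinh_div_cosh]
    exact div_pos (Real.sinh_pos_iff.2 (mul_pos hk hh)) (Real.cosh_pos _)
  set T := Real.tanh (k * h) / k with hTdef
  have hT : 0 < T := div_pos htanh hk
  have hlam' : lam = Υ * T / 2 - √(Υ ^ 2 * T ^ 2 / 4 + g * T) := by
    rw [hlam, hTdef]
    congr 1
    · field_simp
    · congr 1
      field_simp
  obtain ⟨hneg, hquad⟩ := neg_and_sq_eq_of_eq_sub_sqrt hg hT hlam'
  have hcond : Υ < 0 → (Real.tanh (k * h) / (k * h) ≤ Υ ^ 2 * h / (g + Υ ^ 2 * h) ↔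
      Υ * h ≤ lam) := fun hΥ => by
    rw [le_neg_root_iff hneg hg hT hquad (mul_neg_of_neg_of_pos hΥ hh), ← div_div, ← hTdef,
      div_le_div_iff₀ hh (by positivity), ← sub_nonneg]
    ring_nf
  refine ⟨⟨?_, ?_⟩, ?_⟩
  · rintro ⟨Y, ⟨hY0, hYh⟩, hY⟩
    have hΥ : Υ < 0 := by
      by_contra! hle
      nlinarith [mul_nonneg hle (sub_nonneg.2 hYh)]
    refine ⟨hΥ, (hcond hΥ).2 ?_⟩
    nlinarith [mul_nonneg_of_nonpos_of_nonpos hΥ.le (neg_nonpos.2 hY0)]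
  · rintro ⟨hΥ, hle⟩
    have hdepth : lam / Υ ≤ h := (div_le_iff_of_neg hΥ).2 (by linarith [(hcond hΥ).1 hle])
    have hpos : 0 < lam / Υ := div_pos_of_neg_of_neg hneg hΥ
    refine ⟨h - lam / Υ, ⟨by linarith, by linarith⟩, ?_⟩
    field_simp [hΥ.ne]
    ring
  · rintro ⟨hΥ, -⟩
    refine ⟨fun Y _ hY => ?_, sub_lt_self h (div_pos_of_neg_of_neg hneg hΥ)⟩
    rw [eq_sub_iff_add_eq, ← eq_sub_iff_add_eq', div_eq_iff hΥ.ne]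
    linear_combination hY
end

section
/- Let d > 0, let x, s ∈ ℝ and let y ∈ (−2d, 0). Then sinh( (π/(4d))·(s + x + 2d·i + y·i) ) / sinh( (π/(4d))·(s − x − y·i) ) = −( cosh(πs/(2d))·sin(πy/(2d)) − i·( sinh(πs/(2d))·cos(πy/(2d)) − sinh(πx/(2d)) ) ) / ( cosh(π(x−s)/(2d)) − cos(πy/(2d)) ), where the denominator sinh((π/(4d))·(s − x − y·i)) is nonzero and the real denominator cosh(π(x−s)/(2d)) − cos(πy/(2d)) is strictly positive. -/
open Real Complex

theorem Complex.two_mul_cosh_mul_sinh (z w : ℂ) :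
    2 * (Complex.cosh z * Complex.sinh w) = Complex.sinh (z + w) - Complex.sinh (z - w) := by
  rw [Complex.sinh_add, Complex.sinh_sub]
  ring

theorem Complex.two_mul_sinh_mul_sinh (z w : ℂ) :
    2 * (Complex.sinh z * Complex.sinh w) = Complex.cosh (z + w) - Complex.cosh (z - w) := by
  rw [Complex.cosh_add, Complex.cosh_sub]
  ring

theorem Complex.sinh_add_pi_div_two_mul_I (z : ℂ) :
    Complex.sinh (z + π / 2 * Complex.I) = Complex.cosh z * Complex.I := by
  rw [Complex.sinh_add, Complex.sinh_mul_I, Complex.cosh_mul_I, Complex.sin_pi_div_two,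
    Complex.cos_pi_div_two]
  ring

/-- The explicit simplification of the pulled-back Poisson kernel on the strip:
for `d > 0`, `x, s ∈ ℝ` and `y ∈ (−2d, 0)`,
`sinh((π/4d)(s + x + 2di + yi)) / sinh((π/4d)(s − x − yi))` equals
`−(cosh(πs/2d) sin(πy/2d) − i (sinh(πs/2d) cos(πy/2d) − sinh(πx/2d)))
  / (cosh(π(x−s)/2d) − cos(πy/2d))`,
the complex denominator being nonzero and the real denominator strictly positive. -/
theorem poisson_kernel_strip_identity (d x s y : ℝ) (hd : 0 < d)
    (hy : y ∈ Set.Ioo (-(2 * d)) 0) :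
    Complex.sinh (((π : ℂ) / (4 * (d : ℂ))) * ((s : ℂ) - (x : ℂ) - (y : ℂ) * Complex.I)) ≠ 0 ∧
    0 < Real.cosh (π * (x - s) / (2 * d)) - Real.cos (π * y / (2 * d)) ∧
    Complex.sinh (((π : ℂ) / (4 * (d : ℂ))) *
        ((s : ℂ) + (x : ℂ) + 2 * (d : ℂ) * Complex.I + (y : ℂ) * Complex.I)) /
      Complex.sinh (((π : ℂ) / (4 * (d : ℂ))) * ((s : ℂ) - (x : ℂ) - (y : ℂ) * Complex.I)) =
      -(((Real.cosh (π * s / (2 * d)) * Real.sin (π * y / (2 * d)) : ℝ) : ℂ) -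
          Complex.I * ((Real.sinh (π * s / (2 * d)) * Real.cos (π * y / (2 * d)) -
            Real.sinh (π * x / (2 * d)) : ℝ) : ℂ)) /
        ((Real.cosh (π * (x - s) / (2 * d)) - Real.cos (π * y / (2 * d)) : ℝ) : ℂ) := by
  have hdc : (d : ℂ) ≠ 0 := Complex.ofReal_ne_zero.mpr hd.ne'
  have hpos : 0 < Real.cosh (π * (x - s) / (2 * d)) - Real.cos (π * y / (2 * d)) := by
    have hneg : π * y / (2 * d) < 0 :=
      div_neg_of_neg_of_pos (mul_neg_of_pos_of_neg pi_pos hy.2) (by positivity)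
    have hgt : -π < π * y / (2 * d) := by
      rw [lt_div_iff₀ (by positivity)]
      nlinarith [mul_lt_mul_of_pos_left hy.1 pi_pos]
    have hcos : Real.cos (π * y / (2 * d)) < 1 := by
      refine lt_of_le_of_ne (Real.cos_le_one _) fun h => hneg.ne ?_
      exact (Real.cos_eq_one_iff_of_lt_of_lt (by linarith [pi_pos]) (by linarith [pi_pos])).mp h
    linarith [Real.one_le_cosh (π * (x - s) / (2 * d))]
  set D : ℂ := (π : ℂ) / (4 * (d : ℂ)) * ((s : ℂ) - (x : ℂ) - (y : ℂ) * Complex.I) with hD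
  set E : ℂ := (π : ℂ) / (4 * (d : ℂ)) * ((s : ℂ) - (x : ℂ) + (y : ℂ) * Complex.I) with hE
  set N : ℂ := (π : ℂ) / (4 * (d : ℂ)) * ((s : ℂ) + (x : ℂ) + (y : ℂ) * Complex.I) with hN
  have hden : 2 * (Complex.sinh D * Complex.sinh E) =
      ((Real.cosh (π * (x - s) / (2 * d)) - Real.cos (π * y / (2 * d)) : ℝ) : ℂ) := by
    have hadd : D + E = -((π * (x - s) / (2 * d) : ℝ) : ℂ) := by
      rw [hD, hE]
      push_cast
      field_simp
      ring
    have hsub : D - E = -(((π * y / (2 * d) : ℝ) : ℂ) * Complex.I) := by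
      rw [hD, hE]
      push_cast
      field_simp
      ring
    rw [Complex.two_mul_sinh_mul_sinh, hadd, hsub, Complex.cosh_neg, Complex.cosh_neg,
      Complex.cosh_mul_I, Complex.ofReal_sub, Complex.ofReal_cosh, Complex.ofReal_cos]
  have hnum : 2 * (Complex.cosh N * Complex.sinh E) =
      Complex.sinh ((π * s / (2 * d) : ℝ) : ℂ) * Complex.cos ((π * y / (2 * d) : ℝ) : ℂ) +
        Complex.cosh ((π * s / (2 * d) : ℝ) : ℂ) *
          (Complex.sin ((π * y / (2 * d) : ℝ) : ℂ) * Complex.I) -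
        Complex.sinh ((π * x / (2 * d) : ℝ) : ℂ) := by
    have hadd : N + E =
        ((π * s / (2 * d) : ℝ) : ℂ) + ((π * y / (2 * d) : ℝ) : ℂ) * Complex.I := by
      rw [hN, hE]
      push_cast
      field_simp
      ring
    have hsub : N - E = ((π * x / (2 * d) : ℝ) : ℂ) := by
      rw [hN, hE]
      push_cast
      field_simp
      ring
    rw [Complex.two_mul_cosh_mul_sinh, hadd, hsub, Complex.sinh_add, Complex.cosh_mul_I,
      Complex.sinh_mul_I]
  have hshift : (π : ℂ) / (4 * (d : ℂ)) *
      ((s : ℂ) + (x : ℂ) + 2 * (d : ℂ) * Complex.I + (y : ℂ) * Complex.I) =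
      N + π / 2 * Complex.I := by
    rw [hN]
    field_simp
    ring
  have hreal := Complex.ofReal_ne_zero.mpr hpos.ne'
  have hD0 : Complex.sinh D ≠ 0 := fun h => hreal (by rw [← hden, h]; ring)
  refine ⟨hD0, hpos, ?_⟩
  rw [hshift, Complex.sinh_add_pi_div_two_mul_I, div_eq_div_iff hD0 hreal, ← hden]
  push_cast at hnum ⊢
  linear_combination Complex.I * Complex.sinh D * hnum +
    Complex.sinh D * Complex.cosh (π * s / (2 * d)) * Complex.sin (π * y / (2 * d)) *
      Complex.I_sq
end
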